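/- Let (T, q) be a classical solution of the Guyer–Krumhansl system on (0,l) with boundary conditions q(0,t) = q(l,t) = 0, let C_T(t) := (μ² ∂_x q(0,t) − k T(0,t)) ∫_0^l T(s,t) ds, let β := min(2k/(ρc), 4(l² + μ²)/τ_q), ω := β/(3l² + 3μ² + 2τ_q k/(ρc)), M := (3l² + 3μ² + 2τ_q k/(ρc))/(l² + μ²), and γ₀ := (l² + μ²)⁻¹. Then for all t ≥ 0, E(t) ≤ M E(0) e^{−ωt} + γ₀ ∫_0^t |C_T(r)| e^{−ω(t−r)} dr. -/

import Mathlib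

open Set MeasureTheory intervalIntegral

/-- A classical solution of the one-dimensional Guyer–Krumhansl system on `(0, l)`:
`T` is the temperature, `q` the heat flux, and `Tt, Tx, qt, qx, qxx` are the
corresponding partial derivatives (continuous on `[0,l] × [0,∞)`), satisfying
`ρ c T_t + q_x = 0` and `τ_q q_t + q − μ² q_xx + k T_x = 0` on `(0,l) × (0,∞)`,
with adiabatic boundary conditions `q(0,t) = q(l,t) = 0` for all `t ≥ 0`. -/
structure IsGKSolution (l ρ c τq μ2 k : ℝ)
    (T q Tt Tx qt qx qxx : ℝ → ℝ → ℝ) : Prop where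
  contT : ContinuousOn (fun p : ℝ × ℝ => T p.1 p.2) (Icc (0:ℝ) l ×ˢ Ici (0:ℝ))
  contq : ContinuousOn (fun p : ℝ × ℝ => q p.1 p.2) (Icc (0:ℝ) l ×ˢ Ici (0:ℝ))
  hTt : ∀ x ∈ Icc (0:ℝ) l, ∀ t ∈ Ici (0:ℝ),
    HasDerivWithinAt (fun s => T x s) (Tt x t) (Ici (0:ℝ)) t
  hTx : ∀ x ∈ Icc (0:ℝ) l, ∀ t ∈ Ici (0:ℝ),
    HasDerivWithinAt (fun y => T y t) (Tx x t) (Icc (0:ℝ) l) x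
  hqt : ∀ x ∈ Icc (0:ℝ) l, ∀ t ∈ Ici (0:ℝ),
    HasDerivWithinAt (fun s => q x s) (qt x t) (Ici (0:ℝ)) t
  hqx : ∀ x ∈ Icc (0:ℝ) l, ∀ t ∈ Ici (0:ℝ),
    HasDerivWithinAt (fun y => q y t) (qx x t) (Icc (0:ℝ) l) x
  hqxx : ∀ x ∈ Icc (0:ℝ) l, ∀ t ∈ Ici (0:ℝ),
    HasDerivWithinAt (fun y => qx y t) (qxx x t) (Icc (0:ℝ) l) x
  contTt : ContinuousOn (fun p : ℝ × ℝ => Tt p.1 p.2) (Icc (0:ℝ) l ×ˢ Ici (0:ℝ))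
  contTx : ContinuousOn (fun p : ℝ × ℝ => Tx p.1 p.2) (Icc (0:ℝ) l ×ˢ Ici (0:ℝ))
  contqt : ContinuousOn (fun p : ℝ × ℝ => qt p.1 p.2) (Icc (0:ℝ) l ×ˢ Ici (0:ℝ))
  contqx : ContinuousOn (fun p : ℝ × ℝ => qx p.1 p.2) (Icc (0:ℝ) l ×ˢ Ici (0:ℝ))
  contqxx : ContinuousOn (fun p : ℝ × ℝ => qxx p.1 p.2) (Icc (0:ℝ) l ×ˢ Ici (0:ℝ))
  pde1 : ∀ x ∈ Ioo (0:ℝ) l, ∀ t ∈ Ioi (0:ℝ), ρ * c * Tt x t + qx x t = 0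
  pde2 : ∀ x ∈ Ioo (0:ℝ) l, ∀ t ∈ Ioi (0:ℝ),
    τq * qt x t + q x t - μ2 * qxx x t + k * Tx x t = 0
  bc0 : ∀ t : ℝ, 0 ≤ t → q 0 t = 0
  bcl : ∀ t : ℝ, 0 ≤ t → q l t = 0

/-- The functional energy `E(t) = (ρc/2)∫₀ˡ T² dx + (τ_q/(2k))∫₀ˡ q² dx`. -/
noncomputable def gkEnergy (l ρ c τq k : ℝ) (T q : ℝ → ℝ → ℝ) (t : ℝ) : ℝ :=
  ρ * c / 2 * (∫ x in (0:ℝ)..l, (T x t) ^ 2)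
    + τq / (2 * k) * (∫ x in (0:ℝ)..l, (q x t) ^ 2)

/-- The auxiliary functional
`F(t) = (ρc/2)∫₀ˡ (∫ₓˡ T ds)² dx + (ρcμ²/2)∫₀ˡ T² dx + τ_q ∫₀ˡ q (∫ₓˡ T ds) dx`. -/
noncomputable def gkF (l ρ c τq μ2 : ℝ) (T q : ℝ → ℝ → ℝ) (t : ℝ) : ℝ :=
  ρ * c / 2 * (∫ x in (0:ℝ)..l, (∫ s in x..l, T s t) ^ 2)
    + ρ * c * μ2 / 2 * (∫ x in (0:ℝ)..l, (T x t) ^ 2)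
    + τq * (∫ x in (0:ℝ)..l, q x t * (∫ s in x..l, T s t))

/-- The boundary term `C_T(t) = (μ² ∂ₓq(0,t) − k T(0,t)) ∫₀ˡ T(s,t) ds`. -/
noncomputable def gkCT (l μ2 k : ℝ) (T qx : ℝ → ℝ → ℝ) (t : ℝ) : ℝ :=
  (μ2 * qx 0 t - k * T 0 t) * ∫ s in (0:ℝ)..l, T s t

lemma gk_slice {l : ℝ} {f : ℝ → ℝ → ℝ}
    (hf : ContinuousOn (fun p : ℝ × ℝ => f p.1 p.2) (Icc (0:ℝ) l ×ˢ Ici (0:ℝ)))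
    {t : ℝ} (ht : 0 ≤ t) : ContinuousOn (fun x => f x t) (Icc (0:ℝ) l) := by
  have : ContinuousOn (fun x : ℝ => ((x, t) : ℝ × ℝ)) (Icc (0:ℝ) l) := by fun_prop
  exact hf.comp this (fun x hx => ⟨hx, ht⟩)

lemma gk_slice_t {l : ℝ} {f : ℝ → ℝ → ℝ}
    (hf : ContinuousOn (fun p : ℝ × ℝ => f p.1 p.2) (Icc (0:ℝ) l ×ˢ Ici (0:ℝ)))
    {x : ℝ} (hx : x ∈ Icc (0:ℝ) l) : ContinuousOn (fun t => f x t) (Ici (0:ℝ)) := by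
  have : ContinuousOn (fun t : ℝ => ((x, t) : ℝ × ℝ)) (Ici (0:ℝ)) := by fun_prop
  exact hf.comp this (fun t ht => ⟨hx, ht⟩)

lemma gk_primitive_cont {l : ℝ} (hl : 0 < l) {f : ℝ → ℝ → ℝ}
    (hf : ContinuousOn (fun p : ℝ × ℝ => f p.1 p.2) (Icc (0:ℝ) l ×ˢ Ici (0:ℝ))) :
    ContinuousOn (fun p : ℝ × ℝ => ∫ s in p.1..l, f s p.2) (Icc (0:ℝ) l ×ˢ Ici (0:ℝ)) := by
  let g : ℝ → ℝ → ℝ := fun t x => f (max 0 (min x l)) (max t 0)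
  have hg : Continuous g.uncurry := by
    have h1 : Continuous (fun p : ℝ × ℝ => ((max 0 (min p.2 l), max p.1 0) : ℝ × ℝ)) := by
      fun_prop
    refine hf.comp_continuous h1 (fun p => ⟨⟨le_max_left _ _, ?_⟩, mem_Ici.2 (le_max_right _ _)⟩)
    exact max_le hl.le (min_le_right _ _)
  have h2 := continuous_parametric_primitive_of_continuous (μ := volume) (a₀ := l) hg
  have h3 : Continuous (fun p : ℝ × ℝ => -∫ s in l..p.1, g p.2 s) :=
    (h2.comp continuous_swap).neg
  refine h3.continuousOn.congr ?_
  rintro ⟨x, t⟩ ⟨hx, ht⟩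
  simp only [mem_Ici] at ht
  simp only
  rw [integral_symm]
  congr 1
  apply intervalIntegral.integral_congr
  intro s hs
  rw [uIcc_of_ge hx.2] at hs
  simp only [g]
  rw [min_eq_left hs.2, max_eq_right (hx.1.trans hs.1), max_eq_left ht]

lemma gk_param_cont {l : ℝ} (hl : 0 < l) {f : ℝ → ℝ → ℝ}
    (hf : ContinuousOn (fun p : ℝ × ℝ => f p.1 p.2) (Icc (0:ℝ) l ×ˢ Ici (0:ℝ))) :
    ContinuousOn (fun t : ℝ => ∫ s in (0:ℝ)..l, f s t) (Ici (0:ℝ)) :=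
  gk_slice_t (f := fun x t => ∫ s in x..l, f s t) (gk_primitive_cont hl hf) ⟨le_rfl, hl.le⟩

lemma gk_param_deriv {l a : ℝ} (ha : a ∈ Icc (0:ℝ) l) {f f' : ℝ → ℝ → ℝ}
    (hf : ContinuousOn (fun p : ℝ × ℝ => f p.1 p.2) (Icc (0:ℝ) l ×ˢ Ici (0:ℝ)))
    (hf' : ContinuousOn (fun p : ℝ × ℝ => f' p.1 p.2) (Icc (0:ℝ) l ×ˢ Ici (0:ℝ)))
    (hd : ∀ x ∈ Icc (0:ℝ) l, ∀ t, 0 < t → HasDerivAt (fun s => f x s) (f' x t) t)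
    {t : ℝ} (ht : 0 < t) :
    HasDerivAt (fun s => ∫ x in a..l, f x s) (∫ x in a..l, f' x t) t := by
  have hsub : Icc a l ⊆ Icc (0:ℝ) l := Icc_subset_Icc_left ha.1
  have hK : IsCompact (Icc (0:ℝ) l ×ˢ Icc (t/2) (t+1)) := isCompact_Icc.prod isCompact_Icc
  obtain ⟨C, hC⟩ := hK.exists_bound_of_continuousOn
    (hf'.mono (prod_mono_right (fun s hs => (by positivity : 0 ≤ t/2).trans hs.1)))
  have hs : Icc (t/2) (t+1) ∈ nhds t := Icc_mem_nhds (by linarith) (by linarith)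
  have hu : ∀ x ∈ Set.uIoc a l, x ∈ Icc (0:ℝ) l := by
    intro x hx
    rw [uIoc_of_le ha.2] at hx
    exact hsub ⟨hx.1.le, hx.2⟩
  have hmeas : ∀ g : ℝ → ℝ → ℝ,
      ContinuousOn (fun p : ℝ × ℝ => g p.1 p.2) (Icc (0:ℝ) l ×ˢ Ici (0:ℝ)) → ∀ s, 0 ≤ s →
      IntervalIntegrable (fun x => g x s) volume a l := by
    intro g hg s hs
    apply ContinuousOn.intervalIntegrable_of_Icc ha.2
    exact (gk_slice hg hs).mono hsub
  refine (intervalIntegral.hasDerivAt_integral_of_dominated_loc_of_deriv_le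
    (F := fun s x => f x s) (F' := fun s x => f' x s) (bound := fun _ => C) hs ?_ ?_ ?_ ?_ ?_ ?_).2
  · filter_upwards [hs] with s hs
    exact (hmeas f hf s (by have := hs.1; linarith)).def'.aestronglyMeasurable
  · exact hmeas f hf t ht.le
  · exact (hmeas f' hf' t ht.le).def'.aestronglyMeasurable
  · filter_upwards with x hx s hs
    exact hC (x, s) ⟨hu x hx, hs⟩
  · exact intervalIntegrable_const
  · filter_upwards with x hx s hs
    exact hd x (hu x hx) s (by have := hs.1; linarith)

lemma gk_prim_x {l x : ℝ} (hx : x ∈ Ioo (0:ℝ) l) {f : ℝ → ℝ} (hf : ContinuousOn f (Icc (0:ℝ) l)) :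
    HasDerivAt (fun y => ∫ s in y..l, f s) (-f x) x := by
  apply integral_hasDerivAt_left
  · apply ContinuousOn.intervalIntegrable_of_Icc hx.2.le
    exact hf.mono (Icc_subset_Icc_left hx.1.le)
  · exact (hf.mono Ioo_subset_Icc_self).stronglyMeasurableAtFilter isOpen_Ioo x hx
  · exact hf.continuousAt (Icc_mem_nhds hx.1 hx.2)

/-- Cauchy–Schwarz for the primitive, pointwise. -/
lemma gk_cs {l x : ℝ} (hx : x ∈ Icc (0:ℝ) l) {f : ℝ → ℝ} (hf : ContinuousOn f (Icc (0:ℝ) l)) :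
    (∫ s in x..l, f s) ^ 2 ≤ l * ∫ s in (0:ℝ)..l, f s ^ 2 := by
  have hfx := hf.mono (Icc_subset_Icc_left hx.1 : Icc x l ⊆ Icc 0 l)
  have i1 : IntervalIntegrable f volume x l := hfx.intervalIntegrable_of_Icc hx.2
  have i2 : IntervalIntegrable (fun s => f s ^ 2) volume x l :=
    (hfx.pow 2).intervalIntegrable_of_Icc hx.2
  have i3 : IntervalIntegrable (fun s => f s ^ 2) volume 0 x :=
    ((hf.mono (Icc_subset_Icc_right hx.2)).pow 2).intervalIntegrable_of_Icc hx.1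
  set I := ∫ s in x..l, f s with hI
  set J := ∫ s in x..l, f s ^ 2 with hJ
  have hJ0 : 0 ≤ J := integral_nonneg hx.2 (fun s _ => sq_nonneg _)
  have hJJ : J ≤ ∫ s in (0:ℝ)..l, f s ^ 2 := by
    rw [← integral_add_adjacent_intervals i3 i2]
    have : 0 ≤ ∫ s in (0:ℝ)..x, f s ^ 2 := integral_nonneg hx.1 (fun s _ => sq_nonneg _)
    linarith
  have h0 : 0 ≤ ∫ s in x..l, ((l - x) ^ 2 * f s ^ 2 - 2 * (l - x) * I * f s + I ^ 2) := by
    apply integral_nonneg hx.2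
    intro s _
    nlinarith [sq_nonneg ((l - x) * f s - I)]
  rw [intervalIntegral.integral_add ((i2.const_mul _).sub (i1.const_mul _)) intervalIntegrable_const,
    intervalIntegral.integral_sub (i2.const_mul _) (i1.const_mul _),
    intervalIntegral.integral_const_mul, intervalIntegral.integral_const_mul,
    intervalIntegral.integral_const, ← hI, ← hJ, smul_eq_mul] at h0
  have hl0 : 0 ≤ l := hx.1.trans hx.2
  have key : I ^ 2 ≤ (l - x) * J := by
    rcases hx.2.eq_or_lt with h | h
    · have : I = 0 := by rw [hI, h]; exact integral_same
      rw [this, h]; simp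
    · have h2 : 0 ≤ (l - x) * ((l - x) * J - I ^ 2) := by nlinarith
      have := nonneg_of_mul_nonneg_right h2 (by linarith : 0 < l - x)
      linarith
  calc I ^ 2 ≤ (l - x) * J := key
    _ ≤ l * J := mul_le_mul_of_nonneg_right (by linarith [hx.1]) hJ0
    _ ≤ _ := mul_le_mul_of_nonneg_left hJJ hl0

lemma gk_cs2 {l : ℝ} (hl : 0 < l) {f g : ℝ → ℝ} (hf : ContinuousOn f (Icc (0:ℝ) l))
    (hg : ContinuousOn g (Icc (0:ℝ) l)) (hG : ∀ x ∈ Icc (0:ℝ) l, g x = ∫ s in x..l, f s) :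
    (∫ x in (0:ℝ)..l, g x ^ 2) ≤ l ^ 2 * ∫ s in (0:ℝ)..l, f s ^ 2 := by
  have : (∫ x in (0:ℝ)..l, g x ^ 2) ≤ ∫ x in (0:ℝ)..l, (l * ∫ s in (0:ℝ)..l, f s ^ 2) := by
    apply integral_mono_on hl.le ((hg.pow 2).intervalIntegrable_of_Icc hl.le)
      intervalIntegrable_const
    intro x hx
    change g x ^ 2 ≤ _
    rw [hG x hx]
    exact gk_cs hx hf
  rw [intervalIntegral.integral_const, smul_eq_mul] at this
  linarith [this]

/-- Static bounds. -/
lemma gk_cross {l k : ℝ} (hl : 0 < l) (hk : 0 < k) {f g q : ℝ → ℝ}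
    (hf : ContinuousOn f (Icc (0:ℝ) l)) (hq : ContinuousOn q (Icc (0:ℝ) l))
    (hg : ContinuousOn g (Icc (0:ℝ) l)) (hG : ∀ x ∈ Icc (0:ℝ) l, g x = ∫ s in x..l, f s) :
    |2 * k * ∫ x in (0:ℝ)..l, q x * g x| ≤
      l ^ 2 * (∫ x in (0:ℝ)..l, q x ^ 2) + k ^ 2 * ∫ x in (0:ℝ)..l, f x ^ 2 := by
  have h1 := gk_cs2 hl hf hg hG
  have iq : IntervalIntegrable (fun s => q s ^ 2) volume 0 l :=
    (hq.pow 2).intervalIntegrable_of_Icc hl.le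
  have ig : IntervalIntegrable (fun s => g s ^ 2) volume 0 l :=
    (hg.pow 2).intervalIntegrable_of_Icc hl.le
  have iqg : IntervalIntegrable (fun s => q s * g s) volume 0 l :=
    (hq.mul hg).intervalIntegrable_of_Icc hl.le
  have key : ∀ e : ℝ, e ^ 2 = 1 → 0 ≤ l ^ 4 * (∫ x in (0:ℝ)..l, q x ^ 2) +
      (e * 2 * l ^ 2 * k) * (∫ x in (0:ℝ)..l, q x * g x) + k ^ 2 * ∫ x in (0:ℝ)..l, g x ^ 2 := by
    intro e he
    rw [← intervalIntegral.integral_const_mul, ← intervalIntegral.integral_const_mul,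
      ← intervalIntegral.integral_const_mul,
      ← intervalIntegral.integral_add (iq.const_mul _) (iqg.const_mul _),
      ← intervalIntegral.integral_add ((iq.const_mul _).add (iqg.const_mul _)) (ig.const_mul _)]
    apply integral_nonneg hl.le
    intro s _
    have : l ^ 4 * q s ^ 2 + e * 2 * l ^ 2 * k * (q s * g s) + k ^ 2 * g s ^ 2
      = (l ^ 2 * q s + e * k * g s) ^ 2 + (1 - e ^ 2) * (k ^ 2 * g s ^ 2) := by ring
    rw [this, he]
    nlinarith [sq_nonneg (l ^ 2 * q s + e * k * g s)]
  have kp := key 1 (by norm_num)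
  have km := key (-1) (by norm_num)
  set X := ∫ x in (0:ℝ)..l, q x * g x
  set B := ∫ x in (0:ℝ)..l, q x ^ 2
  set A := ∫ x in (0:ℝ)..l, f x ^ 2
  set Γ := ∫ x in (0:ℝ)..l, g x ^ 2
  have h2 : k ^ 2 * Γ ≤ k ^ 2 * (l ^ 2 * A) := mul_le_mul_of_nonneg_left h1 (by positivity)
  have hl2 : 0 < l ^ 2 := by positivity
  rw [abs_le]
  constructor
  · have : 0 ≤ l ^ 2 * (2 * k * X + (l ^ 2 * B + k ^ 2 * A)) := by nlinarith
    linarith [nonneg_of_mul_nonneg_right this hl2]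
  · have : 0 ≤ l ^ 2 * (-(2 * k * X) + (l ^ 2 * B + k ^ 2 * A)) := by nlinarith
    linarith [nonneg_of_mul_nonneg_right this hl2]

/-- Gronwall. -/
lemma gk_gronwall {ω : ℝ} {L L' C : ℝ → ℝ} (hL : ContinuousOn L (Ici 0))
    (hC : ContinuousOn C (Ici 0)) (hd : ∀ t, 0 < t → HasDerivAt L (L' t) t)
    (hle : ∀ t, 0 < t → L' t ≤ -ω * L t + |C t|) {t : ℝ} (ht : 0 ≤ t) :
    L t ≤ L 0 * Real.exp (-ω * t) + ∫ r in (0:ℝ)..t, |C r| * Real.exp (-ω * (t - r)) := by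
  let g : ℝ → ℝ := fun r => |C (max r 0)| * Real.exp (ω * r)
  have hg : Continuous g := by
    have h1 : Continuous (fun r => C (max r 0)) :=
      hC.comp_continuous (by fun_prop) (fun r => mem_Ici.2 (le_max_right _ _))
    exact h1.abs.mul (by fun_prop)
  have hgd : ∀ s, HasDerivAt (fun s => ∫ r in (0:ℝ)..s, g r) (g s) s := fun s =>
    hg.integral_hasStrictDerivAt 0 s |>.hasDerivAt
  have hed : ∀ s : ℝ, HasDerivAt (fun s => Real.exp (ω * s)) (Real.exp (ω * s) * ω) s := by
    intro s
    simpa using ((hasDerivAt_id s).const_mul ω).exp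
  let h : ℝ → ℝ := fun s => Real.exp (ω * s) * L s - ∫ r in (0:ℝ)..s, g r
  have hhd : ∀ s, 0 < s → HasDerivAt h
      (Real.exp (ω * s) * ω * L s + Real.exp (ω * s) * L' s - g s) s := fun s hs =>
    ((hed s).mul (hd s hs)).sub (hgd s)
  have hanti : AntitoneOn h (Ici 0) := by
    apply antitoneOn_of_deriv_nonpos (convex_Ici 0)
    · apply ContinuousOn.sub
      · exact ContinuousOn.mul (by fun_prop) hL
      · exact (continuous_iff_continuousAt.2 fun s => (hgd s).continuousAt).continuousOn
    · rw [interior_Ici]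
      intro s hs
      exact (hhd s hs).differentiableAt.differentiableWithinAt
    · rw [interior_Ici]
      intro s hs
      rw [(hhd s hs).deriv]
      have hs' : 0 < s := hs
      simp only [g]
      rw [max_eq_left hs'.le]
      have := mul_le_mul_of_nonneg_left (hle s hs') (Real.exp_pos (ω * s)).le
      linarith
  have h1 := hanti (mem_Ici.2 le_rfl) (mem_Ici.2 ht) ht
  simp only [h, mul_zero, Real.exp_zero, one_mul, integral_same, sub_zero] at h1
  have h2 : (∫ r in (0:ℝ)..t, |C r| * Real.exp (-ω * (t - r)))
      = Real.exp (-ω * t) * ∫ r in (0:ℝ)..t, g r := by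
    rw [← intervalIntegral.integral_const_mul]
    apply intervalIntegral.integral_congr
    intro r hr
    rw [uIcc_of_le ht] at hr
    simp only [g]
    rw [max_eq_left hr.1, show -ω * (t - r) = -ω * t + ω * r by ring, Real.exp_add]
    ring
  rw [h2]
  have h3 : Real.exp (-ω * t) * Real.exp (ω * t) = 1 := by
    rw [← Real.exp_add]; simp
  have h4 := mul_le_mul_of_nonneg_left h1 (Real.exp_pos (-ω * t)).le
  calc L t = Real.exp (-ω * t) * Real.exp (ω * t) * L t := by rw [h3, one_mul]
    _ ≤ _ := by linarith

set_option maxHeartbeats 2000000 in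
/-- for a classical solution of the Guyer–Krumhansl system, with
`β = min(2k/(ρc), 4(l²+μ²)/τ_q)`, `ω = β/(3l²+3μ²+2τ_q k/(ρc))`,
`M = (3l²+3μ²+2τ_q k/(ρc))/(l²+μ²)` and `γ₀ = (l²+μ²)⁻¹`,
`E(t) ≤ M E(0) e^{−ωt} + γ₀ ∫₀ᵗ |C_T(r)| e^{−ω(t−r)} dr` for all `t ≥ 0`. -/
theorem gk_energy_estimate
    (l ρ c τq μ2 k : ℝ) (hl : 0 < l) (hρ : 0 < ρ) (hc : 0 < c)
    (hτq : 0 < τq) (hμ2 : 0 < μ2) (hk : 0 < k)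
    (T q Tt Tx qt qx qxx : ℝ → ℝ → ℝ)
    (hgk : IsGKSolution l ρ c τq μ2 k T q Tt Tx qt qx qxx)
    (β ω M γ₀ : ℝ)
    (hβ : β = min (2 * k / (ρ * c)) (4 * (l ^ 2 + μ2) / τq))
    (hω : ω = β / (3 * l ^ 2 + 3 * μ2 + 2 * (τq * k / (ρ * c))))
    (hM : M = (3 * l ^ 2 + 3 * μ2 + 2 * (τq * k / (ρ * c))) / (l ^ 2 + μ2))
    (hγ₀ : γ₀ = (l ^ 2 + μ2)⁻¹) :
    ∀ t : ℝ, 0 ≤ t →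
      gkEnergy l ρ c τq k T q t
        ≤ M * gkEnergy l ρ c τq k T q 0 * Real.exp (-ω * t)
          + γ₀ * ∫ r in (0:ℝ)..t, |gkCT l μ2 k T qx r| * Real.exp (-ω * (t - r)) := by
  have hrc : 0 < ρ * c := mul_pos hρ hc
  set S := Icc (0:ℝ) l ×ˢ Ici (0:ℝ) with hS
  obtain ⟨cT, cq, hTt, hTx, hqt, hqx, hqxx, cTt, cTx, cqt, cqx, cqxx, pde1, pde2, bc0, bcl⟩ := hgk
  -- upgraded derivatives
  have dTt : ∀ x ∈ Icc (0:ℝ) l, ∀ t, 0 < t → HasDerivAt (fun s => T x s) (Tt x t) t :=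
    fun x hx t ht => (hTt x hx t ht.le).hasDerivAt (Ici_mem_nhds ht)
  have dqt : ∀ x ∈ Icc (0:ℝ) l, ∀ t, 0 < t → HasDerivAt (fun s => q x s) (qt x t) t :=
    fun x hx t ht => (hqt x hx t ht.le).hasDerivAt (Ici_mem_nhds ht)
  have dTx : ∀ x ∈ Ioo (0:ℝ) l, ∀ t, 0 < t → HasDerivAt (fun y => T y t) (Tx x t) x :=
    fun x hx t ht => (hTx x (Ioo_subset_Icc_self hx) t ht.le).hasDerivAt (Icc_mem_nhds hx.1 hx.2)
  have dqx : ∀ x ∈ Ioo (0:ℝ) l, ∀ t, 0 < t → HasDerivAt (fun y => q y t) (qx x t) x :=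
    fun x hx t ht => (hqx x (Ioo_subset_Icc_self hx) t ht.le).hasDerivAt (Icc_mem_nhds hx.1 hx.2)
  have dqxx : ∀ x ∈ Ioo (0:ℝ) l, ∀ t, 0 < t → HasDerivAt (fun y => qx y t) (qxx x t) x :=
    fun x hx t ht => (hqxx x (Ioo_subset_Icc_self hx) t ht.le).hasDerivAt (Icc_mem_nhds hx.1 hx.2)
  -- the primitive
  obtain ⟨G, hG⟩ : ∃ G : ℝ → ℝ → ℝ, ∀ x t, G x t = ∫ s in x..l, T s t := ⟨_, fun _ _ => rfl⟩
  have cG : ContinuousOn (fun p : ℝ × ℝ => G p.1 p.2) S := by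
    simp only [hG]; exact gk_primitive_cont hl cT
  have dGx : ∀ x ∈ Ioo (0:ℝ) l, ∀ t, 0 < t → HasDerivAt (fun y => G y t) (-T x t) x := by
    intro x hx t ht
    simp only [hG]
    exact gk_prim_x hx (gk_slice cT ht.le)
  have dGt : ∀ x ∈ Icc (0:ℝ) l, ∀ t, 0 < t →
      HasDerivAt (fun s => G x s) (q x t / (ρ * c)) t := by
    intro x hx t ht
    have h1 := gk_param_deriv hx cT cTt dTt ht
    have hsub : Icc x l ⊆ Icc (0:ℝ) l := Icc_subset_Icc_left hx.1
    have h2 : (∫ y in x..l, Tt y t) = q x t / (ρ * c) := by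
      rw [integral_eq_sub_of_hasDerivAt_of_le (f := fun y => -(q y t / (ρ * c))) hx.2]
      · rw [bcl t ht.le]; ring
      · exact ((gk_slice cq ht.le).mono hsub |>.div_const _).neg
      · intro y hy
        have hy' : y ∈ Ioo (0:ℝ) l := ⟨hx.1.trans_lt hy.1, hy.2⟩
        refine HasDerivAt.congr_deriv ((dqx y hy' t ht).div_const (ρ * c)).neg ?_
        have := pde1 y hy' t ht
        field_simp
        linarith
      · exact ((gk_slice cTt ht.le).mono hsub).intervalIntegrable_of_Icc hx.2
    rw [h2] at h1
    simpa only [hG] using h1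
  -- densities
  obtain ⟨lam, hlam⟩ : ∃ lam : ℝ, lam = 2 * (l ^ 2 + μ2) + τq * k / (ρ * c) := ⟨_, rfl⟩
  have hlam0 : 0 < lam := by rw [hlam]; positivity
  obtain ⟨D, hD⟩ : ∃ D : ℝ → ℝ → ℝ, ∀ x t, D x t =
      lam * (ρ * c / 2 * T x t ^ 2 + τq / (2 * k) * q x t ^ 2) + ρ * c / 2 * G x t ^ 2
        + ρ * c * μ2 / 2 * T x t ^ 2 + τq * (q x t * G x t) := ⟨_, fun _ _ => rfl⟩
  obtain ⟨D', hD'⟩ : ∃ D' : ℝ → ℝ → ℝ, ∀ x t, D' x t =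
      lam * (ρ * c * (T x t * Tt x t) + τq / k * (q x t * qt x t)) + G x t * q x t
        + ρ * c * μ2 * (T x t * Tt x t) + τq * (qt x t * G x t + q x t * (q x t / (ρ * c))) :=
    ⟨_, fun _ _ => rfl⟩
  have cD : ContinuousOn (fun p : ℝ × ℝ => D p.1 p.2) S := by
    simp only [hD]; fun_prop
  have cD' : ContinuousOn (fun p : ℝ × ℝ => D' p.1 p.2) S := by
    simp only [hD']; fun_prop
  have dD : ∀ x ∈ Icc (0:ℝ) l, ∀ t, 0 < t → HasDerivAt (fun s => D x s) (D' x t) t := by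
    intro x hx t ht
    simp only [hD]
    have a := dTt x hx t ht
    have b := dqt x hx t ht
    have g := dGt x hx t ht
    refine HasDerivAt.congr_deriv (((((((a.pow 2).const_mul (ρ * c / 2)).add
      ((b.pow 2).const_mul (τq / (2 * k)))).const_mul lam).add
      ((g.pow 2).const_mul (ρ * c / 2))).add ((a.pow 2).const_mul (ρ * c * μ2 / 2))).add
      ((b.mul g).const_mul τq)) ?_
    rw [hD']
    field_simp
    push_cast
    ring
  obtain ⟨L, hL⟩ : ∃ L : ℝ → ℝ, ∀ t, L t = ∫ x in (0:ℝ)..l, D x t := ⟨_, fun _ => rfl⟩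
  have cL : ContinuousOn L (Ici 0) := by
    rw [funext hL]; exact gk_param_cont hl cD
  have dL : ∀ t, 0 < t → HasDerivAt L (∫ x in (0:ℝ)..l, D' x t) t := by
    intro t ht
    rw [funext hL]
    exact gk_param_deriv ⟨le_rfl, hl.le⟩ cD cD' dD ht
  have cC : ContinuousOn (fun t => gkCT l μ2 k T qx t) (Ici 0) := by
    unfold gkCT
    have h0 : (0:ℝ) ∈ Icc (0:ℝ) l := ⟨le_rfl, hl.le⟩
    have a1 := gk_slice_t cqx h0
    have a2 := gk_slice_t cT h0
    have a3 := gk_param_cont hl cT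
    fun_prop
  have sq_int : ∀ f : ℝ → ℝ → ℝ, ContinuousOn (fun p : ℝ × ℝ => f p.1 p.2) S → ∀ t, 0 ≤ t →
      IntervalIntegrable (fun x => f x t ^ 2) volume 0 l := fun f hf t ht =>
    ((gk_slice hf ht).pow 2).intervalIntegrable_of_Icc hl.le
  -- identity for the derivative
  have hL' : ∀ t, 0 < t → (∫ x in (0:ℝ)..l, D' x t) =
      -gkCT l μ2 k T qx t - (lam * (μ2 / k) * (∫ x in (0:ℝ)..l, qx x t ^ 2)
        + (lam / k - τq / (ρ * c)) * (∫ x in (0:ℝ)..l, q x t ^ 2)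
        + k * ∫ x in (0:ℝ)..l, T x t ^ 2) := by
    intro t ht
    have i1 := sq_int qx cqx t ht.le
    have i2 := sq_int q cq t ht.le
    have i3 := sq_int T cT t ht.le
    have sT := gk_slice cT ht.le
    have sq := gk_slice cq ht.le
    have sqx := gk_slice cqx ht.le
    have sG := gk_slice cG ht.le
    have sD' := gk_slice cD' ht.le
    have iR := ((i1.const_mul (lam * (μ2 / k))).add
      (i2.const_mul (lam / k - τq / (ρ * c)))).add (i3.const_mul k)
    have key : (∫ x in (0:ℝ)..l, (D' x t + ((lam * (μ2 / k)) * qx x t ^ 2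
        + (lam / k - τq / (ρ * c)) * q x t ^ 2 + k * T x t ^ 2))) = -gkCT l μ2 k T qx t := by
      rw [integral_eq_sub_of_hasDerivAt_of_le (f := fun x => lam * (-(T x t * q x t)
        + μ2 / k * (q x t * qx x t)) + μ2 * (G x t * qx x t) - k * (G x t * T x t)) hl.le]
      · simp only [bc0 t ht.le, bcl t ht.le]
        have : G l t = 0 := by rw [hG]; exact integral_same
        rw [this, hG]
        unfold gkCT
        ring
      · fun_prop
      · intro x hx
        have a := dTx x hx t ht
        have b := dqx x hx t ht
        have d := dqxx x hx t ht
        have g := dGx x hx t ht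
        refine HasDerivAt.congr_deriv (((((a.mul b).neg.add ((b.mul d).const_mul (μ2 / k))).const_mul lam).add
          ((g.mul d).const_mul μ2)).sub ((g.mul a).const_mul k)) ?_
        rw [hD']
        have e1 : Tt x t = -qx x t / (ρ * c) := by
          have := pde1 x hx t ht
          field_simp
          linarith
        have e2 : qt x t = (-q x t + μ2 * qxx x t - k * Tx x t) / τq := by
          have := pde2 x hx t ht
          field_simp
          linarith
        rw [e1, e2]
        field_simp
        ring
      · exact (sD'.intervalIntegrable_of_Icc hl.le).add iR
    rw [intervalIntegral.integral_add (sD'.intervalIntegrable_of_Icc hl.le) iR,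
      intervalIntegral.integral_add ((i1.const_mul _).add (i2.const_mul _)) (i3.const_mul _),
      intervalIntegral.integral_add (i1.const_mul _) (i2.const_mul _),
      intervalIntegral.integral_const_mul, intervalIntegral.integral_const_mul,
      intervalIntegral.integral_const_mul] at key
    linarith
  -- value of L
  have hLval : ∀ t, 0 ≤ t → L t = lam * gkEnergy l ρ c τq k T q t
      + ρ * c / 2 * (∫ x in (0:ℝ)..l, G x t ^ 2) + ρ * c * μ2 / 2 * (∫ x in (0:ℝ)..l, T x t ^ 2)
      + τq * (∫ x in (0:ℝ)..l, q x t * G x t) := by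
    intro t ht
    have i1 := sq_int G cG t ht
    have i2 := sq_int q cq t ht
    have i3 := sq_int T cT t ht
    have i4 : IntervalIntegrable (fun x => q x t * G x t) volume 0 l :=
      ((gk_slice cq ht).mul (gk_slice cG ht)).intervalIntegrable_of_Icc hl.le
    rw [hL]
    simp only [hD]
    have j1 := ((i3.const_mul (ρ * c / 2)).add (i2.const_mul (τq / (2 * k)))).const_mul lam
    have j2 := i1.const_mul (ρ * c / 2)
    have j3 := i3.const_mul (ρ * c * μ2 / 2)
    have j4 := i4.const_mul τq
    rw [intervalIntegral.integral_add ((j1.add j2).add j3) j4,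
      intervalIntegral.integral_add (j1.add j2) j3, intervalIntegral.integral_add j1 j2,
      intervalIntegral.integral_const_mul,
      intervalIntegral.integral_add (i3.const_mul _) (i2.const_mul _)]
    simp only [intervalIntegral.integral_const_mul]
    rfl
  have hA0 : ∀ t, 0 ≤ ∫ x in (0:ℝ)..l, T x t ^ 2 :=
    fun t => integral_nonneg hl.le (fun s _ => sq_nonneg _)
  have hB0 : ∀ t, 0 ≤ ∫ x in (0:ℝ)..l, q x t ^ 2 :=
    fun t => integral_nonneg hl.le (fun s _ => sq_nonneg _)
  have hQ0 : ∀ t, 0 ≤ ∫ x in (0:ℝ)..l, qx x t ^ 2 :=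
    fun t => integral_nonneg hl.le (fun s _ => sq_nonneg _)
  have hΓ0 : ∀ t, 0 ≤ ∫ x in (0:ℝ)..l, G x t ^ 2 :=
    fun t => integral_nonneg hl.le (fun s _ => sq_nonneg _)
  obtain ⟨N, hN⟩ : ∃ N : ℝ, N = 3 * l ^ 2 + 3 * μ2 + 2 * (τq * k / (ρ * c)) := ⟨_, rfl⟩
  have hN0 : 0 < N := by rw [hN]; positivity
  have hbounds : ∀ t, 0 ≤ t → (l ^ 2 + μ2) * gkEnergy l ρ c τq k T q t ≤ L t ∧
      L t ≤ N * gkEnergy l ρ c τq k T q t := by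
    intro t ht
    have hx := gk_cross hl hk (gk_slice cT ht) (gk_slice cq ht) (gk_slice cG ht)
      (fun x _ => hG x t)
    have hg := gk_cs2 hl (gk_slice cT ht) (gk_slice cG ht) (fun x _ => hG x t)
    rw [hLval t ht]
    unfold gkEnergy
    have hA := hA0 t
    have hB := hB0 t
    have hΓ := hΓ0 t
    set A := ∫ x in (0:ℝ)..l, T x t ^ 2
    set B := ∫ x in (0:ℝ)..l, q x t ^ 2
    set Γ := ∫ x in (0:ℝ)..l, G x t ^ 2
    set X := ∫ x in (0:ℝ)..l, q x t * G x t
    obtain ⟨x1, x2⟩ := abs_le.1 hx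
    have e1 : τq * X = τq / (2 * k) * (2 * k * X) := by field_simp
    have hp : 0 < τq / (2 * k) := by positivity
    have y1 := mul_le_mul_of_nonneg_left x1 hp.le
    have y2 := mul_le_mul_of_nonneg_left x2 hp.le
    rw [← e1] at y1 y2
    have e2 : τq / (2 * k) * (l ^ 2 * B + k ^ 2 * A) = l ^ 2 * (τq / (2 * k) * B)
      + (τq * k / (ρ * c)) * (ρ * c / 2 * A) := by field_simp
    rw [mul_neg, e2] at y1
    rw [e2] at y2
    have z1 : ρ * c / 2 * Γ ≤ l ^ 2 * (ρ * c / 2 * A) := by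
      have := mul_le_mul_of_nonneg_left hg (by positivity : 0 ≤ ρ * c / 2)
      linarith
    have z0 : 0 ≤ ρ * c / 2 * Γ := by positivity
    have e3 : ρ * c * μ2 / 2 * A = μ2 * (ρ * c / 2 * A) := by ring
    rw [e3]
    have ha : 0 ≤ ρ * c / 2 * A := by positivity
    have hb : 0 ≤ τq / (2 * k) * B := by positivity
    have hs : 0 < τq * k / (ρ * c) := by positivity
    set a := ρ * c / 2 * A
    set b := τq / (2 * k) * B
    set s := τq * k / (ρ * c)
    have p1 : 0 ≤ μ2 * a := by positivity
    have p2 : 0 ≤ μ2 * b := by positivity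
    have p3 : 0 ≤ l ^ 2 * a := by positivity
    have p4 : 0 ≤ l ^ 2 * b := by positivity
    have p5 : 0 ≤ s * a := by positivity
    have p6 : 0 ≤ s * b := by positivity
    rw [hlam, hN]
    constructor <;> nlinarith
  have hβ0 : 0 < β := by rw [hβ]; apply lt_min <;> positivity
  rw [← hN] at hω hM
  have hω0 : 0 < ω := by rw [hω]; positivity
  have hineq : ∀ t, 0 < t → (∫ x in (0:ℝ)..l, D' x t) ≤ -ω * L t + |gkCT l μ2 k T qx t| := by
    intro t ht
    rw [hL' t ht]
    have h1 : -gkCT l μ2 k T qx t ≤ |gkCT l μ2 k T qx t| := neg_le_abs _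
    have h2 : ω * L t ≤ β * gkEnergy l ρ c τq k T q t := by
      have := mul_le_mul_of_nonneg_left (hbounds t ht.le).2 hω0.le
      have e : ω * N = β := by rw [hω]; field_simp
      rwa [← mul_assoc, e] at this
    have hA := hA0 t
    have hB := hB0 t
    have hQ := hQ0 t
    unfold gkEnergy at h2
    set A := ∫ x in (0:ℝ)..l, T x t ^ 2
    set B := ∫ x in (0:ℝ)..l, q x t ^ 2
    set Q := ∫ x in (0:ℝ)..l, qx x t ^ 2
    have b1 : β ≤ 2 * k / (ρ * c) := by rw [hβ]; exact min_le_left _ _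
    have b2 : β ≤ 4 * (l ^ 2 + μ2) / τq := by rw [hβ]; exact min_le_right _ _
    have c1 := mul_le_mul_of_nonneg_right b1 (by positivity : 0 ≤ ρ * c / 2 * A)
    have c2 := mul_le_mul_of_nonneg_right b2 (by positivity : 0 ≤ τq / (2 * k) * B)
    have e1 : 2 * k / (ρ * c) * (ρ * c / 2 * A) = k * A := by field_simp
    have e2 : 4 * (l ^ 2 + μ2) / τq * (τq / (2 * k) * B) = (lam / k - τq / (ρ * c)) * B := by
      rw [hlam]; field_simp; ring
    have c3 : 0 ≤ lam * (μ2 / k) * Q := by positivity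
    rw [e1] at c1
    rw [e2] at c2
    linarith
  intro t ht
  have hfin := gk_gronwall cL cC dL hineq ht
  have hm : 0 < l ^ 2 + μ2 := by positivity
  have h1 := (hbounds t ht).1
  have h2 := mul_le_mul_of_nonneg_right (hbounds 0 le_rfl).2 (Real.exp_pos (-ω * t)).le
  have h3 := mul_le_mul_of_nonneg_left (h1.trans (hfin.trans (add_le_add_left h2 _)))
    (inv_pos.2 hm).le
  rw [← mul_assoc, inv_mul_cancel₀ hm.ne', one_mul] at h3
  refine h3.trans (le_of_eq ?_)
  rw [hM, hγ₀]
  ring
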